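/- For all real numbers f_max > 0 and 0 < Δ₁ ≤ Δ₂ < ∞ there exists a constant c > 0, depending only on f_max and Δ₂, with the following property. Let P ≥ 2, let λ₁ ≥ λ₂ ≥ 0, let X₁, X₂ be (possibly dependent) random variables with values in 𝒳_{λ₁+λ₂}, and let g₁, g₂ be real random variables such that (X₁, X₂) is independent of (g₁, g₂) and {g₁, g₂} satisfies the (Δ₁, Δ₂, f_max)-bounded-density assumption. Define Z = ⌊g₁X₁⌋ + ⌊g₂X₂⌋. Then H((X₁)^{λ₁+λ₂}_{λ₁}, (X₂)^{λ₁+λ₂}_{λ₁}) ≤ H(Z | (g₁, g₂)) + c·(1 + log(1 + log P)), where the entropy on the left is the joint entropy of the top power-level parts of X₁ and X₂. -/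

import Mathlib

open MeasureTheory ProbabilityTheory

noncomputable section

/-- Truncation of a real number toward zero. -/
def truncZ (x : ℝ) : ℤ := if 0 ≤ x then ⌊x⌋ else ⌈x⌉

/-- `pbar P lam = ⌊P ^ (lam / 2)⌋`, i.e. `P̄^lam`. -/
def pbar (P lam : ℝ) : ℤ := ⌊P ^ (lam / 2)⌋

/-- The alphabet `𝒳_lam = {0, 1, …, P̄^lam − 1}`. -/
def Xalph (P lam : ℝ) : Set ℤ := {x : ℤ | 0 ≤ x ∧ x < pbar P lam}

/-- `(X)_lam = X − P̄^lam ⌊X / P̄^lam⌋` (division truncated toward zero). -/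
def lowPart (P lam : ℝ) (X : ℤ) : ℤ := X - pbar P lam * (X.tdiv (pbar P lam))

/-- `(X)^hi_lo = ⌊(X − P̄^hi ⌊X / P̄^hi⌋) / P̄^lo⌋` (divisions truncated toward zero). -/
def midPart (P lo hi : ℝ) (X : ℤ) : ℤ := (lowPart P hi X).tdiv (pbar P lo)

/-- Shannon entropy (natural log) of a random variable with (essentially) finite range. -/
def shEntropy {Ω : Type*} [MeasurableSpace Ω] (μ : Measure Ω) {α : Type*} (X : Ω → α) : ℝ :=
  ∑' a : α, Real.negMulLog (μ (X ⁻¹' {a})).toReal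

/-- Conditional Shannon entropy `H(X | Y)`, defined through conditional expectations of
indicators with respect to the σ-algebra generated by `Y`. -/
def shCondEntropy {Ω : Type*} [MeasurableSpace Ω] (μ : Measure Ω) {α β : Type*}
    [MeasurableSpace β] (X : Ω → α) (Y : Ω → β) : ℝ :=
  ∫ ω, ∑' a : α,
    Real.negMulLog
      ((μ[Set.indicator (X ⁻¹' {a}) (fun _ => (1 : ℝ)) | MeasurableSpace.comap Y inferInstance]) ω)
    ∂μ

/-- `X` and `Y` are conditionally independent given `W`. -/
def CondIndepGiven {Ω α β γ : Type*} [MeasurableSpace Ω] [MeasurableSpace α] [MeasurableSpace β]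
    [MeasurableSpace γ] (μ : Measure Ω) (W : Ω → γ) (X : Ω → α) (Y : Ω → β) : Prop :=
  ∀ (A : Set α) (B : Set β), MeasurableSet A → MeasurableSet B →
    (μ[Set.indicator (X ⁻¹' A ∩ Y ⁻¹' B) (fun _ => (1 : ℝ)) |
        MeasurableSpace.comap W inferInstance])
      =ᵐ[μ]
      fun ω =>
        (μ[Set.indicator (X ⁻¹' A) (fun _ => (1 : ℝ)) | MeasurableSpace.comap W inferInstance]) ω *
        (μ[Set.indicator (Y ⁻¹' B) (fun _ => (1 : ℝ)) | MeasurableSpace.comap W inferInstance]) ω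

/-- The conditional distribution of `g` given `V` is a.s. absolutely continuous with
density bounded above by `fmax`: equivalently, the conditional probability of any
measurable set `S` is a.s. at most `fmax · volume S`. -/
def CondDensityBounded {Ω β : Type*} [MeasurableSpace Ω] [MeasurableSpace β]
    (μ : Measure Ω) (g : Ω → ℝ) (V : Ω → β) (fmax : ℝ) : Prop :=
  ∀ S : Set ℝ, MeasurableSet S →
    ∀ᵐ ω ∂μ,
      ENNReal.ofReal
          ((μ[Set.indicator (g ⁻¹' S) (fun _ => (1 : ℝ)) |
              MeasurableSpace.comap V inferInstance]) ω)
        ≤ ENNReal.ofReal fmax * volume S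

/-- Density part of the bounded-density assumption for a family `g`, conditioned on a
random variable `W`: for disjoint subfamilies `s, t`, the conditional joint distribution of
`(g i)_{i ∈ s}` given `(W, (g j)_{j ∈ t})` is a.s. absolutely continuous with joint density
bounded above by `fmax ^ |s|`. -/
def CondBoundedDensityFamily {Ω ι γ : Type*} [MeasurableSpace Ω] [MeasurableSpace γ]
    [DecidableEq ι] (μ : Measure Ω) (W : Ω → γ) (g : ι → Ω → ℝ) (fmax : ℝ) : Prop :=
  ∀ (s t : Finset ι), s.Nonempty → Disjoint s t →
    ∀ S : Set (s → ℝ), MeasurableSet S →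
      ∀ᵐ ω ∂μ,
        ENNReal.ofReal
            ((μ[Set.indicator ((fun ω (i : s) => g i ω) ⁻¹' S) (fun _ => (1 : ℝ)) |
                MeasurableSpace.comap (fun ω => (W ω, fun j : t => g j ω)) inferInstance]) ω)
          ≤ ENNReal.ofReal (fmax ^ s.card) * volume S

/-- The `(Δ₁, Δ₂, fmax)`-bounded-density assumption for a family `g` of real random
variables (Definition 4 of the paper). -/
def BoundedDensityFamily {Ω ι : Type*} [MeasurableSpace Ω] [DecidableEq ι]
    (μ : Measure Ω) (g : ι → Ω → ℝ) (Δ₁ Δ₂ fmax : ℝ) : Prop :=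
  (∀ i, ∀ᵐ ω ∂μ, Δ₁ ≤ |g i ω| ∧ |g i ω| ≤ Δ₂) ∧
  ∀ (s t : Finset ι), s.Nonempty → Disjoint s t →
    ∀ S : Set (s → ℝ), MeasurableSet S →
      ∀ᵐ ω ∂μ,
        ENNReal.ofReal
            ((μ[Set.indicator ((fun ω (i : s) => g i ω) ⁻¹' S) (fun _ => (1 : ℝ)) |
                MeasurableSpace.comap (fun ω (j : t) => g j ω) inferInstance]) ω)
          ≤ ENNReal.ofReal (fmax ^ s.card) * volume S

/-- Partial sums `Λ_i = λ₁ + ⋯ + λ_i` of the power levels (0-based: `cumSum lam i`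
sums the first `i` entries). -/
def cumSum {M : ℕ} (lam : Fin M → ℝ) (i : ℕ) : ℝ :=
  ∑ r ∈ Finset.univ.filter (fun r : Fin M => (r : ℕ) < i), lam r

end

lemma aux_trunc (x : ℝ) : |x - truncZ x| ≤ 1 := by
  unfold truncZ
  split_ifs with h
  · rw [abs_le]; constructor <;> linarith [Int.floor_le x, Int.lt_floor_add_one x]
  · rw [abs_le]; constructor <;> linarith [Int.le_ceil x, Int.ceil_lt_add_one x]

lemma aux_joint {Ω : Type} [MeasurableSpace Ω] (μ : Measure Ω) [IsProbabilityMeasure μ]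
    (g₁ g₂ : Ω → ℝ) (h1 : Measurable g₁) (h2 : Measurable g₂) (Δ₁ Δ₂ fmax : ℝ)
    (h : BoundedDensityFamily μ (fun i : Fin 2 => if i = 0 then g₁ else g₂) Δ₁ Δ₂ fmax)
    (S : Set (ℝ × ℝ)) (hS : MeasurableSet S) :
    μ ((fun ω => (g₁ ω, g₂ ω)) ⁻¹' S) ≤ ENNReal.ofReal (fmax ^ 2) * volume S := by
  classical
  let φ : ({x // x ∈ (Finset.univ : Finset (Fin 2))} → ℝ) → ℝ × ℝ :=
    fun v => (v ⟨0, Finset.mem_univ _⟩, v ⟨1, Finset.mem_univ _⟩)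
  have hφ : MeasurePreserving φ volume volume := by
    have e1 := volume_preserving_finTwoArrow ℝ
    let e : Fin 2 ≃ {x // x ∈ (Finset.univ : Finset (Fin 2))} :=
      (Equiv.subtypeUnivEquiv (fun x => Finset.mem_univ x)).symm
    have e2 := (volume_measurePreserving_piCongrLeft (fun _ => ℝ) e).symm
    have := e1.comp e2
    have hcomp : φ = ⇑MeasurableEquiv.finTwoArrow ∘
        ⇑(MeasurableEquiv.piCongrLeft (fun _ => ℝ) e).symm := by
      funext v; rfl
    rw [hcomp]; exact this
  have hb := h.2 Finset.univ ∅ ⟨0, Finset.mem_univ _⟩ (by simp) (φ ⁻¹' S) (hφ.measurable hS)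
  have hbot : MeasurableSpace.comap (fun ω (j : (∅ : Finset (Fin 2))) =>
      (fun i : Fin 2 => if i = 0 then g₁ else g₂) j ω) inferInstance = (⊥ : MeasurableSpace Ω) := by
    have : (fun ω (j : (∅ : Finset (Fin 2))) =>
      (fun i : Fin 2 => if i = 0 then g₁ else g₂) j ω) = fun _ => (fun _ => (0:ℝ)) := by
      funext ω j
      exact absurd j.2 (Finset.notMem_empty _)
    rw [this, MeasurableSpace.comap_const]
  rw [hbot] at hb
  simp only [condExp_bot] at hb
  obtain ⟨ω, hω⟩ := hb.exists
  have hpre : (fun ω (i : (Finset.univ : Finset (Fin 2))) =>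
      (fun i : Fin 2 => if i = 0 then g₁ else g₂) i ω) ⁻¹' (φ ⁻¹' S)
      = (fun ω => (g₁ ω, g₂ ω)) ⁻¹' S := by
    ext ω; simp [φ]
  have hm : MeasurableSet ((fun ω => (g₁ ω, g₂ ω)) ⁻¹' S) := (h1.prodMk h2) hS
  rw [hpre, hφ.measure_preimage hS.nullMeasurableSet] at hω
  rw [show (fun _ : Ω => (1:ℝ)) = 1 from rfl, integral_indicator_one hm] at hω
  simpa [Measure.real] using hω

lemma aux_strip_meas (D E R : ℝ) :
    MeasurableSet {p : ℝ × ℝ | |p.1 * D + p.2 * E| ≤ 4 ∧ |p.2| ≤ R} := by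
  apply IsClosed.measurableSet
  rw [Set.ofPred_and]
  exact (isClosed_le (by fun_prop) (by fun_prop)).inter (isClosed_le (by fun_prop) (by fun_prop))

lemma aux_strip (D E R : ℝ) (hD : D ≠ 0) (hR : 0 ≤ R) :
    volume {p : ℝ × ℝ | |p.1 * D + p.2 * E| ≤ 4 ∧ |p.2| ≤ R} ≤ ENNReal.ofReal (16 * R / |D|) := by
  have hm : MeasurableSet {p : ℝ × ℝ | |p.1 * D + p.2 * E| ≤ 4 ∧ |p.2| ≤ R} := by
    exact aux_strip_meas _ _ _
  rw [Measure.volume_eq_prod, Measure.prod_apply_symm hm]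
  have hD' : 0 < |D| := abs_pos.mpr hD
  calc _ ≤ ∫⁻ y, (Set.Icc (-R) R).indicator (fun _ => ENNReal.ofReal (8 / |D|)) y := by
        apply lintegral_mono
        intro y
        by_cases hy : |y| ≤ R
        · rw [Set.indicator_of_mem (by exact abs_le.mp hy)]
          refine (measure_mono (t := Set.Icc (-(y*E)/D - 4/|D|) (-(y*E)/D + 4/|D|)) ?_).trans ?_
          · intro x hx
            have hx1 : |x * D + y * E| ≤ 4 := hx.1
            have : |x - (-(y*E)/D)| ≤ 4/|D| := by
              rw [le_div_iff₀ hD', ← abs_mul]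
              rw [sub_mul, div_mul_cancel₀ _ hD, sub_neg_eq_add]; exact hx1
            rw [abs_le] at this
            constructor <;> linarith
          · rw [Real.volume_Icc]
            apply ENNReal.ofReal_le_ofReal
            apply le_of_eq; ring
        · have : ((fun x => (x, y)) ⁻¹' {p : ℝ × ℝ | |p.1 * D + p.2 * E| ≤ 4 ∧ |p.2| ≤ R}) = ∅ := by
            ext x; simp [hy]
          simp [this]
    _ ≤ _ := by
        rw [lintegral_indicator measurableSet_Icc, lintegral_const, Measure.restrict_apply_univ,
          Real.volume_Icc, ← ENNReal.ofReal_mul (by positivity)]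
        apply ENNReal.ofReal_le_ofReal
        apply le_of_eq; ring

lemma aux_strip_prob {Ω : Type} [MeasurableSpace Ω] (μ : Measure Ω) [IsProbabilityMeasure μ]
    (g₁ g₂ : Ω → ℝ) (h1 : Measurable g₁) (h2 : Measurable g₂) (Δ₁ Δ₂ fmax : ℝ) (hΔ : 0 < Δ₂)
    (h : BoundedDensityFamily μ (fun i : Fin 2 => if i = 0 then g₁ else g₂) Δ₁ Δ₂ fmax)
    (D E : ℝ) :
    (D ≠ 0 → μ.real {ω | |g₁ ω * D + g₂ ω * E| ≤ 4} ≤ fmax ^ 2 * (16 * Δ₂ / |D|)) ∧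
    (E ≠ 0 → μ.real {ω | |g₁ ω * D + g₂ ω * E| ≤ 4} ≤ fmax ^ 2 * (16 * Δ₂ / |E|)) := by
  have hg1 := h.1 0
  have hg2 := h.1 1
  simp only [if_true, one_ne_zero, if_false] at hg1 hg2
  constructor
  · intro hD
    have hm : MeasurableSet {p : ℝ × ℝ | |p.1 * D + p.2 * E| ≤ 4 ∧ |p.2| ≤ Δ₂} := by
      exact aux_strip_meas _ _ _
    apply ENNReal.toReal_le_of_le_ofReal (by positivity)
    rw [ENNReal.ofReal_mul (by positivity)]
    refine le_trans ?_ (mul_le_mul_right (aux_strip D E Δ₂ hD hΔ.le) _)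
    refine le_trans ?_ (aux_joint μ g₁ g₂ h1 h2 Δ₁ Δ₂ fmax h _ hm)
    apply measure_mono_ae
    filter_upwards [hg2] with ω hω hx
    exact ⟨hx, hω.2⟩
  · intro hE
    have hm : MeasurableSet {p : ℝ × ℝ | |p.1 * E + p.2 * D| ≤ 4 ∧ |p.2| ≤ Δ₂} := by
      exact aux_strip_meas _ _ _
    apply ENNReal.toReal_le_of_le_ofReal (by positivity)
    rw [ENNReal.ofReal_mul (by positivity)]
    refine le_trans ?_ (mul_le_mul_right (aux_strip E D Δ₂ hE hΔ.le) _)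
    rw [Measure.volume_eq_prod, ← (Measure.measurePreserving_swap (μ := (volume : Measure ℝ)) (ν := (volume : Measure ℝ))).measure_preimage hm.nullMeasurableSet]
    refine le_trans ?_ (aux_joint μ g₁ g₂ h1 h2 Δ₁ Δ₂ fmax h _ (measurable_swap hm))
    apply measure_mono_ae
    filter_upwards [hg1] with ω hω hx
    refine ⟨?_, hω.2⟩
    have hx' : |g₁ ω * D + g₂ ω * E| ≤ 4 := hx
    simpa [add_comm] using hx'

lemma aux_entropy {α β : Type*} [DecidableEq β] (F : Finset α) (p : α → ℝ) (φ : α → β) :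
    ∑' b, Real.negMulLog (∑ x ∈ F with φ x = b, p x)
      = -∑ x ∈ F, p x * Real.log (∑ x' ∈ F with φ x' = φ x, p x') := by
  rw [tsum_eq_sum (s := F.image φ)]
  · rw [← Finset.sum_fiberwise_of_maps_to (s := F) (t := F.image φ) (g := φ)
      (fun x hx => Finset.mem_image_of_mem _ hx), ← Finset.sum_neg_distrib]
    refine Finset.sum_congr rfl fun b _ => ?_
    rw [Real.negMulLog, neg_mul, Finset.sum_mul]
    congr 1
    refine Finset.sum_congr rfl fun x hx => ?_
    rw [(Finset.mem_filter.mp hx).2]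
  · intro b hb
    have : F.filter (fun x => φ x = b) = ∅ := by
      apply Finset.filter_eq_empty_iff.mpr
      intro x hx h
      exact hb (Finset.mem_image.mpr ⟨x, hx, h⟩)
    simp [this]

lemma aux_le_fiber {α β : Type*} [DecidableEq β] (F : Finset α) (p : α → ℝ)
    (hp : ∀ x, 0 ≤ p x) (φ : α → β) (x : α) (hx : x ∈ F) :
    p x ≤ ∑ x' ∈ F with φ x' = φ x, p x' :=
  Finset.single_le_sum (f := p) (fun i _ => hp i) (by simp [hx])

lemma aux_pt {α β γ : Type*} [DecidableEq β] [DecidableEq γ] (F : Finset α) (p : α → ℝ)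
    (hp : ∀ x, 0 ≤ p x) (a : α → β) (z : α → γ) :
    -∑ x ∈ F, p x * Real.log (∑ x' ∈ F with a x' = a x, p x')
      ≤ -∑ x ∈ F, p x * Real.log (∑ x' ∈ F with z x' = z x, p x')
        + ∑ x ∈ F, ∑ x' ∈ F, p x * p x' / (∑ x' ∈ F with a x' = a x, p x')
          * (if z x' = z x then 1 else 0) := by
  rw [← Finset.sum_neg_distrib, ← Finset.sum_neg_distrib, ← Finset.sum_add_distrib]
  refine Finset.sum_le_sum fun x hx => ?_
  set r := ∑ x' ∈ F with a x' = a x, p x' with hr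
  set q := ∑ x' ∈ F with z x' = z x, p x' with hq
  have e : ∑ x' ∈ F, p x * p x' / r * (if z x' = z x then 1 else 0) = p x * (q / r) := by
    rw [hq, Finset.sum_filter, Finset.sum_div, Finset.mul_sum]
    refine Finset.sum_congr rfl fun x' _ => ?_
    split_ifs <;> ring
  rw [e]
  rcases (hp x).eq_or_lt with h0 | h0
  · simp [← h0]
  have hr0 : 0 < r := h0.trans_le (aux_le_fiber F p hp a x hx)
  have hq0 : 0 < q := h0.trans_le (aux_le_fiber F p hp z x hx)
  have := Real.log_le_sub_one_of_pos (div_pos hq0 hr0)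
  rw [Real.log_div hq0.ne' hr0.ne'] at this
  nlinarith

lemma aux_K {α β : Type*} [DecidableEq β] (F : Finset α) (p : α → ℝ)
    (hp : ∀ x, 0 ≤ p x) (hp1 : ∑ x ∈ F, p x = 1) (a : α → β) (K : β → β → ℝ)
    (hK : ∀ b b', 0 ≤ K b b') (C : ℝ) (hC : ∀ b', ∑ b ∈ F.image a, K b b' ≤ C) :
    ∑ x ∈ F, ∑ x' ∈ F, p x * p x' / (∑ x' ∈ F with a x' = a x, p x') * K (a x) (a x') ≤ C := by
  rw [Finset.sum_comm]
  calc _ ≤ ∑ x' ∈ F, p x' * C := by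
        refine Finset.sum_le_sum fun x' _ => ?_
        refine le_trans ?_ (mul_le_mul_of_nonneg_left (hC (a x')) (hp x'))
        rw [← Finset.sum_fiberwise_of_maps_to (s := F) (t := F.image a) (g := a)
          (fun x hx => Finset.mem_image_of_mem _ hx), Finset.mul_sum]
        refine Finset.sum_le_sum fun b _ => ?_
        have : ∑ x ∈ F with a x = b, p x * p x' / (∑ x' ∈ F with a x' = a x, p x') * K (a x) (a x')
            = ((∑ x ∈ F with a x = b, p x) / (∑ x ∈ F with a x = b, p x)) * (p x' * K b (a x')) := by
          rw [Finset.sum_div, Finset.sum_mul]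
          refine Finset.sum_congr rfl fun x hx => ?_
          rw [(Finset.mem_filter.mp hx).2]
          ring
        rw [this]
        exact mul_le_of_le_one_left (mul_nonneg (hp _) (hK _ _)) (div_self_le_one _)
    _ = C := by rw [← Finset.sum_mul, hp1, one_mul]

lemma aux_condexp {Ω β : Type} [mΩ : MeasurableSpace Ω] [MeasurableSpace β] (μ : Measure Ω)
    [IsProbabilityMeasure μ] (X : Ω → ℤ × ℤ) (G : Ω → β) (hX : Measurable X) (hG : Measurable G)
    (hind : IndepFun X G μ) (F : Finset (ℤ × ℤ)) (hF : ∀ ω, X ω ∈ F)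
    (ζ : ℤ × ℤ → β → ℤ) (hζ : ∀ x, Measurable (ζ x)) (z : ℤ) :
    μ[Set.indicator ((fun ω => ζ (X ω) (G ω)) ⁻¹' {z}) (fun _ => (1 : ℝ)) |
      MeasurableSpace.comap G inferInstance]
      =ᵐ[μ] fun ω => ∑ x ∈ F with ζ x (G ω) = z, μ.real (X ⁻¹' {x}) := by
  classical
  have hdec : Set.indicator ((fun ω => ζ (X ω) (G ω)) ⁻¹' {z}) (fun _ => (1 : ℝ))
      = ∑ x ∈ F, Set.indicator (G ⁻¹' (ζ x ⁻¹' {z})) (Set.indicator (X ⁻¹' {x}) (fun _ => (1:ℝ))) := by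
    funext ω
    rw [Finset.sum_apply, Finset.sum_eq_single (X ω)]
    · simp [Set.indicator_apply]
    · intro x _ hx
      simp [Set.indicator_apply, hx.symm]
    · intro h; exact absurd (hF ω) h
  rw [hdec]
  have hi : ∀ x, Integrable (Set.indicator (X ⁻¹' {x}) (fun _ => (1:ℝ))) μ := fun x =>
    (integrable_const (1:ℝ)).indicator (hX (measurableSet_singleton x))
  have hs : ∀ x, MeasurableSet[MeasurableSpace.comap G inferInstance] (G ⁻¹' (ζ x ⁻¹' {z})) :=
    fun x => ⟨_, hζ x (measurableSet_singleton z), rfl⟩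
  have hsum := condExp_finsetSum (μ := μ) (s := F)
    (f := fun x => Set.indicator (G ⁻¹' (ζ x ⁻¹' {z})) (Set.indicator (X ⁻¹' {x}) (fun _ => (1:ℝ))))
    (fun x _ => (hi x).indicator (hG.comap_le _ (hs x))) (MeasurableSpace.comap G inferInstance)
  have h1 : ∀ x, μ[Set.indicator (G ⁻¹' (ζ x ⁻¹' {z})) (Set.indicator (X ⁻¹' {x}) (fun _ => (1:ℝ))) |
      MeasurableSpace.comap G inferInstance] =ᵐ[μ]
      Set.indicator (G ⁻¹' (ζ x ⁻¹' {z})) (fun _ => μ.real (X ⁻¹' {x})) := by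
    intro x
    refine (condExp_indicator (hi x) (hs x)).trans ?_
    have h2 := condExp_indep_eq (μ := μ) hX.comap_le hG.comap_le
      (f := Set.indicator (X ⁻¹' {x}) (fun _ => (1:ℝ)))
      (stronglyMeasurable_const.indicator ⟨_, measurableSet_singleton x, rfl⟩) hind
    filter_upwards [h2] with ω hω
    rw [Set.indicator_apply, Set.indicator_apply, hω]
    congr 1
    exact integral_indicator_one (hX (measurableSet_singleton x))
  have h1' := ae_all_iff.mpr h1
  filter_upwards [hsum, h1'] with ω hω hω'
  rw [hω, Finset.sum_apply, Finset.sum_filter]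
  refine Finset.sum_congr rfl fun x _ => ?_
  rw [hω' x]
  simp [Set.indicator_apply]

lemma aux_core {Ω β : Type} [mΩ : MeasurableSpace Ω] [MeasurableSpace β] (μ : Measure Ω)
    [IsProbabilityMeasure μ] (X : Ω → ℤ × ℤ) (G : Ω → β) (hX : Measurable X) (hG : Measurable G)
    (hind : IndepFun X G μ) (F : Finset (ℤ × ℤ)) (hF : ∀ ω, X ω ∈ F)
    (ζ : ℤ × ℤ → β → ℤ) (hζ : ∀ x, Measurable (ζ x)) (a : ℤ × ℤ → ℤ × ℤ)
    (K : ℤ × ℤ → ℤ × ℤ → ℝ) (hK : ∀ b b', 0 ≤ K b b') (C : ℝ)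
    (hC : ∀ b', ∑ b ∈ F.image a, K b b' ≤ C)
    (hKp : ∀ x ∈ F, ∀ x' ∈ F, μ.real {ω | ζ x' (G ω) = ζ x (G ω)} ≤ K (a x) (a x')) :
    shEntropy μ (fun ω => a (X ω)) ≤ shCondEntropy μ (fun ω => ζ (X ω) (G ω)) G + C := by
  classical
  set p : ℤ × ℤ → ℝ := fun x => μ.real (X ⁻¹' {x}) with hpdef
  have hp : ∀ x, 0 ≤ p x := fun x => measureReal_nonneg
  have hfib : ∀ s : Finset (ℤ × ℤ), ∑ x ∈ s, p x = μ.real (X ⁻¹' s) := by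
    intro s
    rw [hpdef]
    have := sum_measureReal_preimage_singleton (μ := μ) s (f := X)
      (fun y _ => hX (measurableSet_singleton y))
    exact this
  have hp1 : ∑ x ∈ F, p x = 1 := by
    rw [hfib, show X ⁻¹' (F : Set (ℤ × ℤ)) = Set.univ from Set.eq_univ_of_forall hF]
    simp
  have hEnt : shEntropy μ (fun ω => a (X ω))
      = -∑ x ∈ F, p x * Real.log (∑ x' ∈ F with a x' = a x, p x') := by
    rw [← aux_entropy, shEntropy]
    refine tsum_congr fun b => ?_
    congr 1
    rw [hfib]
    change μ.real _ = _
    congr 1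
    ext ω
    simp [hF ω]
  have hm : ∀ x x', MeasurableSet {ω | ζ x' (G ω) = ζ x (G ω)} := fun x x' =>
    measurableSet_eq_fun ((hζ x').comp hG) ((hζ x).comp hG)
  have hCond : shCondEntropy μ (fun ω => ζ (X ω) (G ω)) G
      = ∫ ω, -∑ x ∈ F, p x * Real.log (∑ x' ∈ F with ζ x' (G ω) = ζ x (G ω), p x') ∂μ := by
    rw [shCondEntropy]
    apply integral_congr_ae
    have := ae_all_iff.mpr (aux_condexp μ X G hX hG hind F hF ζ hζ)
    filter_upwards [this] with ω hω
    rw [← aux_entropy F p (fun x => ζ x (G ω))]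
    refine tsum_congr fun z => ?_
    rw [hω z]
  have hint1 : Integrable (fun ω =>
      -∑ x ∈ F, p x * Real.log (∑ x' ∈ F with ζ x' (G ω) = ζ x (G ω), p x')) μ := by
    apply Integrable.neg
    apply integrable_finsetSum
    intro x hx
    have hmq : Measurable (fun ω => ∑ x' ∈ F with ζ x' (G ω) = ζ x (G ω), p x') := by
      simp_rw [Finset.sum_filter]
      refine Finset.measurable_sum _ fun x' _ => ?_
      exact Measurable.ite (hm x x') measurable_const measurable_const
    refine Integrable.of_bound (C := |p x * Real.log (p x)|)
      ((Real.measurable_log.comp hmq).const_mul _).aestronglyMeasurable (ae_of_all _ fun ω => ?_)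
    rw [Real.norm_eq_abs, abs_mul, abs_mul]
    rcases (hp x).eq_or_lt with h0 | h0
    · simp [← h0]
    have h2 := aux_le_fiber F p hp (fun x => ζ x (G ω)) x hx
    have h3 : ∑ x' ∈ F with ζ x' (G ω) = ζ x (G ω), p x' ≤ 1 := by
      rw [← hp1]
      exact Finset.sum_le_sum_of_subset_of_nonneg (Finset.filter_subset _ _) (fun i _ _ => hp i)
    have h4 := Real.log_le_log h0 h2
    have h5 := Real.log_nonpos (h0.le.trans h2) h3
    apply mul_le_mul_of_nonneg_left _ (abs_nonneg _)
    rw [abs_of_nonpos h5, abs_of_nonpos (h4.trans h5)]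
    linarith
  have hite : ∀ x x', (fun ω => if ζ x' (G ω) = ζ x (G ω) then (1:ℝ) else 0)
      = Set.indicator {ω | ζ x' (G ω) = ζ x (G ω)} (fun _ => (1:ℝ)) := by
    intro x x'
    funext ω
    simp [Set.indicator_apply]
  have hint0 : ∀ x x', Integrable (fun ω => p x * p x' / (∑ x' ∈ F with a x' = a x, p x')
          * (if ζ x' (G ω) = ζ x (G ω) then (1:ℝ) else 0)) μ := by
    intro x x'
    apply Integrable.const_mul
    rw [hite x x']
    exact (integrable_const (μ := μ) (1:ℝ)).indicator (hm x x')
  have hint2 : Integrable (fun ω => ∑ x ∈ F, ∑ x' ∈ F,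
      p x * p x' / (∑ x' ∈ F with a x' = a x, p x')
          * (if ζ x' (G ω) = ζ x (G ω) then (1:ℝ) else 0)) μ :=
    integrable_finsetSum _ fun x _ => integrable_finsetSum _ fun x' _ => hint0 x x'
  have hI := integral_mono (μ := μ) (integrable_const (shEntropy μ (fun ω => a (X ω))))
    (hint1.add hint2) (fun ω => by
      simp only [hEnt]; exact aux_pt F p hp a (fun x => ζ x (G ω)))
  simp only [Pi.add_apply] at hI
  rw [integral_add hint1 hint2, ← hCond] at hI
  simp only [integral_const, probReal_univ, one_smul] at hI
  refine hI.trans ?_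
  gcongr
  rw [integral_finsetSum _ fun x _ => integrable_finsetSum _ fun x' _ => hint0 x x']
  refine le_trans ?_ (aux_K F p hp hp1 a K hK C hC)
  refine Finset.sum_le_sum fun x hx => ?_
  rw [integral_finsetSum _ fun x' _ => hint0 x x']
  refine Finset.sum_le_sum fun x' hx' => ?_
  rw [integral_const_mul]
  apply mul_le_mul_of_nonneg_left
  · refine le_trans (le_of_eq ?_) (hKp x hx x' hx')
    rw [hite x x']
    exact integral_indicator_one (hm x x')
  · exact div_nonneg (mul_nonneg (hp _) (hp _)) (Finset.sum_nonneg fun i _ => hp i)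

lemma aux_row (s : Finset ℤ) (n0 m : ℤ) (L : ℝ) (hL : 0 ≤ L) :
    ∑ n ∈ s, (if |n - n0| ≤ |m| ∧ m ≠ 0 then L / |(m : ℝ)| else 0) ≤ 3 * L := by
  by_cases hm : m = 0
  · simp [hm, hL]
  have hm' : (1 : ℝ) ≤ |(m : ℝ)| := by
    rw [← Int.cast_abs]; exact_mod_cast Int.one_le_abs hm
  have h0 : 0 ≤ L / |(m : ℝ)| := by positivity
  rw [← Finset.sum_filter, Finset.sum_const, nsmul_eq_mul]
  have hcard : ((s.filter (fun n => |n - n0| ≤ |m| ∧ m ≠ 0)).card : ℝ) ≤ 2 * |(m : ℝ)| + 1 := by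
    have h1 : (s.filter (fun n => |n - n0| ≤ |m| ∧ m ≠ 0)) ⊆ Finset.Icc (n0 - |m|) (n0 + |m|) := by
      intro n hn
      have := (abs_le.mp (Finset.mem_filter.mp hn).2.1)
      rw [Finset.mem_Icc]
      constructor <;> linarith
    have h2 := Finset.card_le_card h1
    rw [Int.card_Icc] at h2
    have h3 : ((s.filter (fun n => |n - n0| ≤ |m| ∧ m ≠ 0)).card : ℤ) ≤ 2 * |m| + 1 := by
      have := abs_nonneg m
      omega
    exact_mod_cast h3
  calc _ ≤ (3 * |(m : ℝ)|) * (L / |(m : ℝ)|) := by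
        apply mul_le_mul_of_nonneg_right _ h0
        linarith
    _ = 3 * L := by field_simp

/-- The kernel bounding collision probabilities. -/
noncomputable def auxK (L : ℝ) (b b' : ℤ × ℤ) : ℝ :=
  (if |b.1 - b'.1| ≤ 1 ∧ |b.2 - b'.2| ≤ 1 then 1 else 0)
  + (if |b.2 - b'.2| ≤ |b.1 - b'.1| ∧ b.1 - b'.1 ≠ 0 then L / |((b.1 - b'.1 : ℤ) : ℝ)| else 0)
  + (if |b.1 - b'.1| ≤ |b.2 - b'.2| ∧ b.2 - b'.2 ≠ 0 then L / |((b.2 - b'.2 : ℤ) : ℝ)| else 0)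

lemma auxK_nonneg (L : ℝ) (hL : 0 ≤ L) (b b' : ℤ × ℤ) : 0 ≤ auxK L b b' := by
  unfold auxK
  have : ∀ x : ℝ, 0 ≤ L / |x| := fun x => by positivity
  have h1 := this ((b.1 - b'.1 : ℤ) : ℝ)
  have h2 := this ((b.2 - b'.2 : ℤ) : ℝ)
  split_ifs <;> linarith

lemma auxK_sum (L : ℝ) (hL : 0 ≤ L) (s : Finset ℤ) (b' : ℤ × ℤ) :
    ∑ b ∈ s ×ˢ s, auxK L b b' ≤ 9 + 6 * L * s.card := by
  unfold auxK
  rw [Finset.sum_add_distrib, Finset.sum_add_distrib]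
  have h1 : ∑ b ∈ s ×ˢ s, (if |b.1 - b'.1| ≤ 1 ∧ |b.2 - b'.2| ≤ 1 then (1:ℝ) else 0) ≤ 9 := by
    rw [← Finset.sum_filter, Finset.sum_const, nsmul_eq_mul, mul_one]
    have hsub : (s ×ˢ s).filter (fun b => |b.1 - b'.1| ≤ 1 ∧ |b.2 - b'.2| ≤ 1)
        ⊆ Finset.Icc (b'.1 - 1) (b'.1 + 1) ×ˢ Finset.Icc (b'.2 - 1) (b'.2 + 1) := by
      intro b hb
      obtain ⟨h1, h2⟩ := (Finset.mem_filter.mp hb).2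
      rw [abs_le] at h1 h2
      rw [Finset.mem_product, Finset.mem_Icc, Finset.mem_Icc]
      refine ⟨⟨?_, ?_⟩, ?_, ?_⟩ <;> linarith
    have h2 := Finset.card_le_card hsub
    rw [Finset.card_product, Int.card_Icc, Int.card_Icc] at h2
    have e1 : (b'.1 + 1 + 1 - (b'.1 - 1)).toNat = 3 := by omega
    have e2 : (b'.2 + 1 + 1 - (b'.2 - 1)).toNat = 3 := by omega
    rw [e1, e2] at h2
    exact_mod_cast h2
  have h2 : ∑ b ∈ s ×ˢ s, (if |b.2 - b'.2| ≤ |b.1 - b'.1| ∧ b.1 - b'.1 ≠ 0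
      then L / |((b.1 - b'.1 : ℤ) : ℝ)| else 0) ≤ 3 * L * s.card := by
    rw [Finset.sum_product]
    refine (Finset.sum_le_sum fun m _ => aux_row s b'.2 (m - b'.1) L hL).trans ?_
    rw [Finset.sum_const, nsmul_eq_mul]; linarith
  have h3 : ∑ b ∈ s ×ˢ s, (if |b.1 - b'.1| ≤ |b.2 - b'.2| ∧ b.2 - b'.2 ≠ 0
      then L / |((b.2 - b'.2 : ℤ) : ℝ)| else 0) ≤ 3 * L * s.card := by
    rw [Finset.sum_product_right]
    refine (Finset.sum_le_sum fun m _ => aux_row s b'.1 (m - b'.2) L hL).trans ?_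
    rw [Finset.sum_const, nsmul_eq_mul]; linarith
  linarith

/-- Cells at distance at least two are separated. -/
lemma aux_sep (Q x y : ℤ) (hQ : 0 < Q) (h : 2 ≤ |x / Q - y / Q|) :
    (Q : ℝ) * |((x / Q - y / Q : ℤ) : ℝ)| / 2 ≤ |((x - y : ℤ) : ℝ)| := by
  have key : Q * |x / Q - y / Q| ≤ 2 * |x - y| := by
    have hx := Int.mul_ediv_add_emod x Q
    have hy := Int.mul_ediv_add_emod y Q
    have hx0 := Int.emod_nonneg x hQ.ne'
    have hy0 := Int.emod_nonneg y hQ.ne'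
    have hx1 := Int.emod_lt_of_pos x hQ
    have hy1 := Int.emod_lt_of_pos y hQ
    generalize x / Q = u at *
    generalize y / Q = v at *
    have l1 := le_abs_self (x - y)
    have l2 := neg_abs_le (x - y)
    rcases abs_cases (u - v) with ⟨h1, _⟩ | ⟨h1, _⟩
    · rw [h1] at h ⊢; nlinarith
    · rw [h1] at h ⊢; nlinarith
  have : (Q : ℝ) * |((x / Q - y / Q : ℤ) : ℝ)| ≤ 2 * |((x - y : ℤ) : ℝ)| := by
    rw [← Int.cast_abs, ← Int.cast_abs]; exact_mod_cast key
  linarith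

lemma aux_half (t : ℝ) (ht : 1 ≤ t) : t / 2 ≤ (⌊t⌋ : ℝ) := by
  have h1 : (1 : ℝ) ≤ (⌊t⌋ : ℝ) := by exact_mod_cast Int.le_floor.mpr (by simpa using ht)
  linarith [Int.lt_floor_add_one t]

lemma aux_card (P lam1 lam2 : ℝ) (hP : 2 ≤ P) (h2 : 0 ≤ lam2) (h12 : lam2 ≤ lam1) :
    ((Finset.Icc 0 ((pbar P (lam1 + lam2)) / (pbar P lam1))).card : ℝ) ≤ 6 * pbar P lam1 := by
  have hP1 : 1 ≤ P := by linarith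
  have hP0 : 0 < P := by linarith
  have a1 : (1:ℝ) ≤ P ^ (lam1 / 2) := Real.one_le_rpow hP1 (by linarith)
  have a2 : (1:ℝ) ≤ P ^ (lam2 / 2) := Real.one_le_rpow hP1 (by linarith)
  have a3 : P ^ (lam2 / 2) ≤ P ^ (lam1 / 2) := Real.rpow_le_rpow_of_exponent_le hP1 (by linarith)
  have a4 : P ^ ((lam1 + lam2) / 2) = P ^ (lam1 / 2) * P ^ (lam2 / 2) := by
    rw [← Real.rpow_add hP0]; congr 1; ring
  have hQ := aux_half _ a1
  have hN : (pbar P (lam1 + lam2) : ℝ) ≤ P ^ (lam1 / 2) * P ^ (lam2 / 2) := by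
    rw [← a4]; exact Int.floor_le _
  change _ ≤ (pbar P lam1 : ℝ) at hQ
  have hQ0 : 0 < pbar P lam1 := by
    have : (0:ℝ) < (pbar P lam1 : ℝ) := by linarith
    exact_mod_cast this
  have hN0 : 0 ≤ pbar P (lam1 + lam2) := by
    apply Int.floor_nonneg.mpr; positivity
  have hd0 : 0 ≤ (pbar P (lam1 + lam2)) / (pbar P lam1) := Int.ediv_nonneg hN0 hQ0.le
  have hmul : ((pbar P (lam1 + lam2) / pbar P lam1 : ℤ) : ℝ) * (pbar P lam1 : ℝ)
      ≤ pbar P (lam1 + lam2) := by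
    exact_mod_cast Int.ediv_mul_le _ hQ0.ne'
  set d : ℤ := pbar P (lam1 + lam2) / pbar P lam1
  have hc : ((Finset.Icc 0 d).card : ℝ) = (d : ℝ) + 1 := by
    have : ((Finset.Icc 0 d).card : ℤ) = d + 1 := by
      rw [Int.card_Icc]; omega
    exact_mod_cast this
  rw [hc]
  have hd0' : (0:ℝ) ≤ d := by exact_mod_cast hd0
  have : (d : ℝ) ≤ 2 * P ^ (lam2 / 2) := by
    have h5 : (d:ℝ) * (P ^ (lam1 / 2) / 2) ≤ P ^ (lam1 / 2) * P ^ (lam2 / 2) :=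
      (mul_le_mul_of_nonneg_left hQ hd0').trans (hmul.trans hN)
    have h6 : P ^ (lam1 / 2) * (d:ℝ) ≤ P ^ (lam1 / 2) * (2 * P ^ (lam2 / 2)) := by linarith
    exact le_of_mul_le_mul_left h6 (by linarith)
  linarith

lemma aux_collide (u v u' v' : ℝ)
    (h : truncZ u' + truncZ v' = truncZ u + truncZ v) : |(u - u') + (v - v')| ≤ 4 := by
  have h1 := abs_le.mp (aux_trunc u)
  have h2 := abs_le.mp (aux_trunc v)
  have h3 := abs_le.mp (aux_trunc u')
  have h4 := abs_le.mp (aux_trunc v')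
  have h5 : (truncZ u' : ℝ) + truncZ v' = truncZ u + truncZ v := by exact_mod_cast h
  rw [abs_le]; constructor <;> linarith

lemma aux_truncZ_meas : Measurable truncZ := by
  unfold truncZ
  exact Measurable.ite measurableSet_Ici Int.measurable_floor Int.measurable_ceil

open MeasureTheory ProbabilityTheory in
theorem stmt_4 (fmax Δ₂ : ℝ) (hfmax : 0 < fmax) (hΔ₂ : 0 < Δ₂) :
    ∃ c : ℝ, 0 < c ∧
      ∀ (Δ₁ : ℝ), 0 < Δ₁ → Δ₁ ≤ Δ₂ →
      ∀ (P lam1 lam2 : ℝ), 2 ≤ P → 0 ≤ lam2 → lam2 ≤ lam1 →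
      ∀ (Ω : Type) [MeasurableSpace Ω] (μ : Measure Ω) [IsProbabilityMeasure μ]
        (X₁ X₂ : Ω → ℤ) (g₁ g₂ : Ω → ℝ),
        Measurable X₁ → Measurable X₂ → Measurable g₁ → Measurable g₂ →
        (∀ ω, X₁ ω ∈ Xalph P (lam1 + lam2)) → (∀ ω, X₂ ω ∈ Xalph P (lam1 + lam2)) →
        IndepFun (fun ω => (X₁ ω, X₂ ω)) (fun ω => (g₁ ω, g₂ ω)) μ →
        BoundedDensityFamily μ (fun i : Fin 2 => if i = 0 then g₁ else g₂) Δ₁ Δ₂ fmax →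
        shEntropy μ (fun ω =>
          (midPart P lam1 (lam1 + lam2) (X₁ ω), midPart P lam1 (lam1 + lam2) (X₂ ω)))
          ≤ shCondEntropy μ
              (fun ω => truncZ (g₁ ω * (X₁ ω : ℝ)) + truncZ (g₂ ω * (X₂ ω : ℝ)))
              (fun ω => (g₁ ω, g₂ ω))
            + c * (1 + Real.log (1 + Real.log P)) := by
  refine ⟨9 + 36 * (32 * fmax ^ 2 * Δ₂), by positivity, ?_⟩
  intro Δ₁ hΔ₁ hΔ P lam1 lam2 hP hl2 hl12 Ω _ μ _ X₁ X₂ g₁ g₂ hX₁ hX₂ hg₁ hg₂ hA₁ hA₂ hind hB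
  have hlog : 0 ≤ Real.log (1 + Real.log P) := by
    have : 0 ≤ Real.log P := Real.log_nonneg (by linarith)
    exact Real.log_nonneg (by linarith)
  set B : ℝ := 32 * fmax ^ 2 * Δ₂ with hBdef
  have hB0 : 0 ≤ B := by positivity
  set Q := pbar P lam1 with hQdef
  set N := pbar P (lam1 + lam2) with hNdef
  have hQ1 : 1 ≤ Q := by
    apply Int.le_floor.mpr
    simpa using Real.one_le_rpow (by linarith : (1:ℝ) ≤ P) (by linarith : 0 ≤ lam1 / 2)
  have hQ0 : 0 < Q := by omega
  have hQr : (0:ℝ) < Q := by exact_mod_cast hQ0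
  have hmid : ∀ x : ℤ, x ∈ Xalph P (lam1 + lam2) → midPart P lam1 (lam1 + lam2) x = x / Q := by
    intro x hx
    obtain ⟨h0, h1⟩ := hx
    have : x.tdiv (pbar P (lam1 + lam2)) = 0 := Int.tdiv_eq_zero_of_lt h0 h1
    rw [midPart, lowPart, this, mul_zero, sub_zero, ← hQdef, Int.tdiv_eq_ediv_of_nonneg h0]
  let F : Finset (ℤ × ℤ) := Finset.Ico 0 N ×ˢ Finset.Ico 0 N
  let a : ℤ × ℤ → ℤ × ℤ := fun x => (x.1 / Q, x.2 / Q)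
  let ζ : ℤ × ℤ → ℝ × ℝ → ℤ := fun x g => truncZ (g.1 * (x.1 : ℝ)) + truncZ (g.2 * (x.2 : ℝ))
  have himg : F.image a ⊆ Finset.Icc 0 (N / Q) ×ˢ Finset.Icc 0 (N / Q) := by
    intro b hb
    obtain ⟨x, hx, rfl⟩ := Finset.mem_image.mp hb
    simp only [F, Finset.mem_product, Finset.mem_Ico] at hx
    simp only [a, Finset.mem_product, Finset.mem_Icc]
    exact ⟨⟨Int.ediv_nonneg hx.1.1 hQ0.le, Int.ediv_le_ediv hQ0 hx.1.2.le⟩,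
      Int.ediv_nonneg hx.2.1 hQ0.le, Int.ediv_le_ediv hQ0 hx.2.2.le⟩
  have hL0 : 0 ≤ B / Q := by positivity
  have hmain := aux_core μ (fun ω => (X₁ ω, X₂ ω)) (fun ω => (g₁ ω, g₂ ω)) (hX₁.prodMk hX₂)
    (hg₁.prodMk hg₂) hind F
    (fun ω => by
      simp only [F, Finset.mem_product, Finset.mem_Ico]
      exact ⟨hA₁ ω, hA₂ ω⟩)
    ζ (fun x => (aux_truncZ_meas.comp (measurable_fst.mul_const _)).add
      (aux_truncZ_meas.comp (measurable_snd.mul_const _)))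
    a (auxK (B / Q)) (auxK_nonneg _ hL0) (9 + 36 * B)
    (fun b' => by
      refine (Finset.sum_le_sum_of_subset_of_nonneg himg
        (fun i _ _ => auxK_nonneg _ hL0 _ _)).trans ((auxK_sum _ hL0 _ b').trans ?_)
      have hc := aux_card P lam1 lam2 hP hl2 hl12
      have : 6 * (B / Q) * ((Finset.Icc 0 (N / Q)).card : ℝ) ≤ 6 * (B / Q) * (6 * Q) :=
        mul_le_mul_of_nonneg_left hc (by positivity)
      have e : 6 * (B / Q) * (6 * (Q:ℝ)) = 36 * B := by field_simp; ring
      linarith)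
    (fun x _ x' _ => by
      have hsub : μ.real {ω | ζ x' (g₁ ω, g₂ ω) = ζ x (g₁ ω, g₂ ω)}
          ≤ μ.real {ω | |g₁ ω * ((x.1 - x'.1 : ℤ) : ℝ) + g₂ ω * ((x.2 - x'.2 : ℤ) : ℝ)| ≤ 4} := by
        apply measureReal_mono _ (measure_ne_top _ _)
        intro ω hω
        have := aux_collide _ _ _ _ hω
        change |_| ≤ (4:ℝ)
        push_cast
        rw [mul_sub, mul_sub]
        exact this
      obtain ⟨s1, s2⟩ := aux_strip_prob μ g₁ g₂ hg₁ hg₂ Δ₁ Δ₂ fmax hΔ₂ hB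
        ((x.1 - x'.1 : ℤ) : ℝ) ((x.2 - x'.2 : ℤ) : ℝ)
      have hdiv : ∀ D : ℝ, 0 ≤ (B / Q) / |D| := fun D => by positivity
      -- a far coordinate gives the strip bound
      have hfar : ∀ y y' : ℤ, 2 ≤ |y / Q - y' / Q| → ((y - y' : ℤ) : ℝ) ≠ 0 ∧
          fmax ^ 2 * (16 * Δ₂ / |((y - y' : ℤ) : ℝ)|) ≤ (B / Q) / |((y / Q - y' / Q : ℤ) : ℝ)| := by
        intro y y' h
        have hs := aux_sep Q y y' hQ0 h
        have hm : (2:ℝ) ≤ |((y / Q - y' / Q : ℤ) : ℝ)| := by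
          rw [← Int.cast_abs]; exact_mod_cast h
        have hpos : 0 < (Q:ℝ) * |((y / Q - y' / Q : ℤ) : ℝ)| / 2 := by positivity
        have hpos2 := hpos.trans_le hs
        refine ⟨abs_pos.mp hpos2, ?_⟩
        calc fmax ^ 2 * (16 * Δ₂ / |((y - y' : ℤ) : ℝ)|)
            ≤ fmax ^ 2 * (16 * Δ₂ / ((Q:ℝ) * |((y / Q - y' / Q : ℤ) : ℝ)| / 2)) := by gcongr
          _ = _ := by rw [hBdef]; field_simp; ring
      unfold auxK
      have hd1 := hdiv (((a x).1 - (a x').1 : ℤ) : ℝ)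
      have hd2 := hdiv (((a x).2 - (a x').2 : ℤ) : ℝ)
      by_cases hnear : |(a x).1 - (a x').1| ≤ 1 ∧ |(a x).2 - (a x').2| ≤ 1
      · rw [if_pos hnear]
        have : μ.real {ω | ζ x' (g₁ ω, g₂ ω) = ζ x (g₁ ω, g₂ ω)} ≤ 1 := measureReal_le_one
        split_ifs <;> linarith
      rw [if_neg hnear]
      rcases le_total |(a x).2 - (a x').2| |(a x).1 - (a x').1| with hle | hle
      · have h2 : 2 ≤ |(a x).1 - (a x').1| := by
          by_contra hcon
          exact hnear ⟨by omega, by omega⟩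
        have hne : (a x).1 - (a x').1 ≠ 0 := by
          intro h0; rw [h0] at h2; simp at h2
        rw [if_pos ⟨hle, hne⟩]
        obtain ⟨f1, f2⟩ := hfar x.1 x'.1 h2
        have := (hsub.trans (s1 f1)).trans f2
        change _ ≤ (B / Q) / |(((a x).1 - (a x').1 : ℤ) : ℝ)| at this
        split_ifs <;> linarith
      · have h2 : 2 ≤ |(a x).2 - (a x').2| := by
          by_contra hcon
          exact hnear ⟨by omega, by omega⟩
        have hne : (a x).2 - (a x').2 ≠ 0 := by
          intro h0; rw [h0] at h2; simp at h2
        rw [if_pos (⟨hle, hne⟩ : |(a x).1 - (a x').1| ≤ |(a x).2 - (a x').2| ∧ (a x).2 - (a x').2 ≠ 0)]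
        obtain ⟨f1, f2⟩ := hfar x.2 x'.2 h2
        have := (hsub.trans (s2 f1)).trans f2
        change _ ≤ (B / Q) / |(((a x).2 - (a x').2 : ℤ) : ℝ)| at this
        split_ifs <;> linarith)
  have hEq : (fun ω => (midPart P lam1 (lam1 + lam2) (X₁ ω), midPart P lam1 (lam1 + lam2) (X₂ ω)))
      = fun ω => a (X₁ ω, X₂ ω) := by
    funext ω
    rw [hmid _ (hA₁ ω), hmid _ (hA₂ ω)]
  rw [hEq]
  refine hmain.trans ?_
  have hfin : 9 + 36 * B ≤ (9 + 36 * B) * (1 + Real.log (1 + Real.log P)) :=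
    le_mul_of_one_le_right (by positivity) (by linarith)
  exact add_le_add_right hfin _
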